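/- For every integer m ≥ 2 and every p ≥ 1, the inequality log^{m-2}((exp^{m-1} t)^p) ≤ exp^{m-1}((log^{m-2} t)^p) holds for all sufficiently large t. -/

import Mathlib

open Set Filter

theorem Real.eventually_mul_le_rpow {p : ℝ} (hp : 1 ≤ p) :
    ∀ᶠ x : ℝ in atTop, p * x ≤ x ^ p := by
  rcases hp.eq_or_lt with rfl | hp
  · simp
  · filter_upwards [(tendsto_rpow_atTop (sub_pos.2 hp)).eventually_ge_atTop p,
      eventually_gt_atTop 0] with x hpx hx
    calc p * x ≤ x ^ (p - 1) * x := by gcongr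
      _ = x ^ p := by rw [Real.rpow_sub_one hx.ne', div_mul_cancel₀ _ hx.ne']

theorem Real.exists_monotoneOn_iterate_log (k : ℕ) :
    ∃ M : ℝ, MonotoneOn Real.log^[k] (Ici M) := by
  induction k with
  | zero => exact ⟨0, monotone_id.monotoneOn _⟩
  | succ k ih =>
    obtain ⟨M, hM⟩ := ih
    refine ⟨Real.exp M, fun x hx y hy hxy => ?_⟩
    have hx0 : 0 < x := (Real.exp_pos M).trans_le hx
    have hy0 : 0 < y := hx0.trans_le hxy
    exact hM ((Real.le_log_iff_exp_le hx0).2 hx) ((Real.le_log_iff_exp_le hy0).2 hy)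
      (Real.log_le_log hx0 hxy)

theorem Real.tendsto_iterate_exp_atTop (k : ℕ) : Tendsto Real.exp^[k] atTop atTop :=
  Tendsto.iterate Real.tendsto_exp_atTop k

theorem Real.eventually_iterate_log_iterate_exp_rpow_le {p : ℝ} (hp : 1 ≤ p) (k : ℕ) :
    ∀ᶠ x : ℝ in atTop, Real.log^[k] ((Real.exp^[k] x) ^ p) ≤ x ^ p := by
  induction k with
  | zero => simp
  | succ k ih =>
    obtain ⟨M, hM⟩ := Real.exists_monotoneOn_iterate_log k
    have hexp := Real.tendsto_iterate_exp_atTop k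
    filter_upwards [ih, hexp.eventually (Real.eventually_mul_le_rpow hp),
      hexp.eventually_ge_atTop M, hexp.eventually_ge_atTop 0] with x hx hmul hxM hx0
    have hle : Real.exp^[k] x ≤ p * Real.exp^[k] x := le_mul_of_one_le_left hx0 hp
    rw [Function.iterate_succ_apply, Function.iterate_succ_apply',
      Real.log_rpow (Real.exp_pos _), Real.log_exp]
    exact (hM (hxM.trans hle) ((hxM.trans hle).trans hmul) hmul).trans hx

theorem Real.eventually_mul_le_iterate_exp_iterate_log_rpow {p : ℝ} (hp : 1 ≤ p) (k : ℕ) :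
    ∀ᶠ t : ℝ in atTop, p * t ≤ Real.exp^[k] ((Real.log^[k] t) ^ p) := by
  induction k with
  | zero => exact Real.eventually_mul_le_rpow hp
  | succ k ih =>
    filter_upwards [Real.tendsto_log_atTop.eventually ih, Real.eventually_mul_le_rpow hp,
      eventually_gt_atTop 0] with t ht hmul ht0
    rw [Function.iterate_succ_apply', Function.iterate_succ_apply]
    calc p * t ≤ t ^ p := hmul
      _ = Real.exp (p * Real.log t) := by rw [Real.rpow_def_of_pos ht0, mul_comm]
      _ ≤ _ := Real.exp_le_exp.2 ht

/-- For every integer `m ≥ 2` and every `p ≥ 1`,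
`log^{m-2}((exp^{m-1} t)^p) ≤ exp^{m-1}((log^{m-2} t)^p)` for all sufficiently large `t`. -/
theorem iterated_log_exp_rpow_le (m : ℕ) (hm : 2 ≤ m) (p : ℝ) (hp : 1 ≤ p) :
    ∃ t₀ : ℝ, ∀ t ≥ t₀,
      Real.log^[m - 2] ((Real.exp^[m - 1] t) ^ p) ≤ Real.exp^[m - 1] ((Real.log^[m - 2] t) ^ p) := by
  obtain ⟨k, rfl⟩ := Nat.exists_eq_add_of_le' hm
  rw [← eventually_atTop]
  filter_upwards [Real.tendsto_exp_atTop.eventually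
      (Real.eventually_iterate_log_iterate_exp_rpow_le hp k),
    Real.eventually_mul_le_iterate_exp_iterate_log_rpow hp k] with t hlog hexp
  calc Real.log^[k] ((Real.exp^[k + 1] t) ^ p) ≤ Real.exp t ^ p := hlog
    _ = Real.exp (p * t) := by rw [← Real.exp_mul, mul_comm]
    _ ≤ Real.exp (Real.exp^[k] ((Real.log^[k] t) ^ p)) := Real.exp_le_exp.2 hexp
    _ = Real.exp^[k + 1] ((Real.log^[k] t) ^ p) := (Function.iterate_succ_apply' ..).symm
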